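/- Let A ⊆ 2^ω, let Y ⊆ 2^ω be countable, let Σ ⊆ ℙ(A)_Y be a maximal antichain of ℙ(A) (pairwise incompatible, and every element of ℙ(A) is compatible with some member of Σ), let F : Σ → ω be any function, and let (p,(t_i,n_i,m_i : i<N)) be a Y-template. Then there exists k < ω such that for every x⃗ ∈ ∏_{i<N}[t_i] there exists q ∈ Σ with p(x⃗) ∪ q ∈ ℙ(A) and F(q) < k. -/

import Mathlib

open Set

/-- Formal sentences for the poset ℙ(A): type (1) `mem x n` is ⌜x ∈ ⋂_{m<ω} U_{n,m}⌝,
type (2) `notMem x n m` is ⌜x ∉ U_{n,m}⌝, type (3) `cylSub s n m` is ⌜[s] ⊆ U_{n,m}⌝. -/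
inductive PSentence : Type
  | mem (x : ℕ → Bool) (n : ℕ)
  | notMem (x : ℕ → Bool) (n m : ℕ)
  | cylSub (s : List Bool) (n m : ℕ)

/-- The basic clopen set [s] = {y ∈ 2^ω : s ⊆ y}. -/
def cyl (s : List Bool) : Set (ℕ → Bool) := {y | ∀ i : Fin s.length, y i = s.get i}

/-- x↾k, the length-k initial segment of x. -/
def restr (x : ℕ → Bool) (k : ℕ) : List Bool := List.ofFn (fun i : Fin k => x i)

/-- Consistency of a set of sentences. -/
def PConsistent (p : Set PSentence) : Prop :=
  (∀ x n k, ¬(PSentence.mem x n ∈ p ∧ PSentence.notMem x n k ∈ p)) ∧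
  (∀ x n m k, ¬(PSentence.notMem x n m ∈ p ∧ PSentence.cylSub (restr x k) n m ∈ p))

/-- The poset ℙ(A): finite consistent sets of sentences whose type (1) sentences
only mention points of A. -/
def PP (A : Set (ℕ → Bool)) : Set (Set PSentence) :=
  {p | p.Finite ∧ (∀ x n, PSentence.mem x n ∈ p → x ∈ A) ∧ PConsistent p}

/-- p and q are compatible iff p ∪ q ∈ ℙ(A). -/
def PCompatible (A : Set (ℕ → Bool)) (p q : Set PSentence) : Prop := p ∪ q ∈ PP A

/-- D is dense in ℙ(A) iff every p ∈ ℙ(A) has an extension (superset) in D. -/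
def PDense (A : Set (ℕ → Bool)) (D : Set (Set PSentence)) : Prop :=
  ∀ p ∈ PP A, ∃ q ∈ D, p ⊆ q

/-- A filter on ℙ(A): a nonempty subset of ℙ(A) closed under subsets (in ℙ(A))
and such that any two members have a common extension in G. -/
def PFilter (A : Set (ℕ → Bool)) (G : Set (Set PSentence)) : Prop :=
  G ⊆ PP A ∧ G.Nonempty ∧
  (∀ p ∈ G, ∀ q ∈ PP A, q ⊆ p → q ∈ G) ∧
  (∀ p ∈ G, ∀ q ∈ G, ∃ r ∈ G, p ⊆ r ∧ q ⊆ r)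

/-- A sentence is in G iff it belongs to some condition in G. -/
def SentIn (G : Set (Set PSentence)) (σ : PSentence) : Prop := ∃ p ∈ G, σ ∈ p

/-- U^G_{n,m} = ⋃{[s] : ⌜[s] ⊆ U_{n,m}⌝ ∈ G}. -/
def Ugen (G : Set (Set PSentence)) (n m : ℕ) : Set (ℕ → Bool) :=
  ⋃ s ∈ {s | SentIn G (PSentence.cylSub s n m)}, cyl s

/-- W^G_n = ⋂_{m<ω} U^G_{n,m}. -/
def Wgen (G : Set (Set PSentence)) (n : ℕ) : Set (ℕ → Bool) := ⋂ m, Ugen G n m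

/-- The dense set D_{x,n,m}. -/
def Dxnm (A : Set (ℕ → Bool)) (x : ℕ → Bool) (n m : ℕ) : Set (Set PSentence) :=
  {p ∈ PP A | (∃ k, PSentence.cylSub (restr x k) n m ∈ p) ∨ PSentence.notMem x n m ∈ p}

/-- The dense set D_{x,n}. -/
def Dxn (A : Set (ℕ → Bool)) (x : ℕ → Bool) (n : ℕ) : Set (Set PSentence) :=
  {p ∈ PP A | (∃ k, PSentence.notMem x n k ∈ p) ∨ PSentence.mem x n ∈ p}

/-- The dense set D_x. -/
def Dx (A : Set (ℕ → Bool)) (x : ℕ → Bool) : Set (Set PSentence) :=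
  {p ∈ PP A | ∃ n, PSentence.mem x n ∈ p}

/-- ℙ(A)_Y: the conditions all of whose type (1) and type (2) sentences
mention only points of Y. -/
def PPY (A Y : Set (ℕ → Bool)) : Set (Set PSentence) :=
  {p | p ∈ PP A ∧ ∀ x, ((∃ n, PSentence.mem x n ∈ p) ∨ (∃ n m, PSentence.notMem x n m ∈ p)) → x ∈ Y}

/-- (p,(t_i,n_i,m_i : i<N)) is a Y-template. -/
def IsTemplate (A Y : Set (ℕ → Bool)) (N : ℕ) (p : Set PSentence)
    (t : Fin N → List Bool) (nn mm : Fin N → ℕ) : Prop :=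
  p ∈ PPY A Y ∧
  (∀ i : Fin N, ∀ y, PSentence.mem y (nn i) ∈ p → y ∉ cyl (t i)) ∧
  (∀ i : Fin N, ∀ s, PSentence.cylSub s (nn i) (mm i) ∈ p → cyl s ∩ cyl (t i) = ∅)

/-- p(x⃗) = p ∪ {⌜x_i ∉ U_{n_i,m_i}⌝ : i < N}. -/
def pvec (p : Set PSentence) {N : ℕ} (nn mm : Fin N → ℕ)
    (x : Fin N → (ℕ → Bool)) : Set PSentence :=
  p ∪ {σ | ∃ i : Fin N, σ = PSentence.notMem (x i) (nn i) (mm i)}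

/-- Σ is an antichain in ℙ(A): a set of pairwise incompatible conditions. -/
def PAntichain (A : Set (ℕ → Bool)) (S : Set (Set PSentence)) : Prop :=
  S ⊆ PP A ∧ ∀ p ∈ S, ∀ q ∈ S, p ≠ q → ¬ PCompatible A p q

/-- Σ is a maximal antichain in ℙ(A). -/
def PMaxAntichain (A : Set (ℕ → Bool)) (S : Set (Set PSentence)) : Prop :=
  PAntichain A S ∧ ∀ p ∈ PP A, ∃ q ∈ S, PCompatible A p q

theorem mem_cyl_iff_restr_eq {x : ℕ → Bool} {s : List Bool} :
    x ∈ cyl s ↔ restr x s.length = s := by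
  constructor
  · intro h
    refine List.ext_getElem (by simp [restr]) fun j h₁ h₂ => ?_
    simpa [restr] using h ⟨j, h₂⟩
  · intro h j
    have hj : j.1 < (restr x s.length).length := by simp [restr]
    have : (restr x s.length)[j.1] = s[j.1] := by simp only [h]
    simpa [restr] using this

theorem isClosed_cyl (s : List Bool) : IsClosed (cyl s) := by
  simp only [cyl, ofPred_forall]
  exact isClosed_iInter fun i => isClosed_eq (continuous_apply _) continuous_const

theorem PP.mono {A : Set (ℕ → Bool)} {p q : Set PSentence} (hq : q ∈ PP A) (h : p ⊆ q) :
    p ∈ PP A :=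
  ⟨hq.1.subset h, fun x n hx => hq.2.1 x n (h hx),
    fun x n k hx => hq.2.2.1 x n k ⟨h hx.1, h hx.2⟩,
    fun x n m k hx => hq.2.2.2 x n m k ⟨h hx.1, h hx.2⟩⟩

/-- Adding the sentences `⌜x i ∉ U_{n i, m i}⌝` to a condition `r` gives a condition as long as
no `x i` is one of the points, or lies in one of the cylinders, that `r` puts into `U_{n i, m i}`. -/
theorem pvec_mem_PP_iff {A : Set (ℕ → Bool)} {r : Set PSentence} {N : ℕ} {nn mm : Fin N → ℕ}
    {x : Fin N → (ℕ → Bool)} :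
    pvec r nn mm x ∈ PP A ↔ r ∈ PP A ∧ ∀ i,
      (∀ y ∈ {y | PSentence.mem y (nn i) ∈ r}, x i ∉ ({y} : Set (ℕ → Bool))) ∧
      (∀ s ∈ {s | PSentence.cylSub s (nn i) (mm i) ∈ r}, x i ∉ cyl s) := by
  constructor
  · intro h
    refine ⟨PP.mono h subset_union_left, fun i => ⟨?_, ?_⟩⟩
    · rintro y hy rfl
      exact h.2.2.1 (x i) (nn i) (mm i) ⟨Or.inl hy, Or.inr ⟨i, rfl⟩⟩
    · intro s hs hx
      refine h.2.2.2 (x i) (nn i) (mm i) s.length ⟨Or.inr ⟨i, rfl⟩, Or.inl ?_⟩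
      rwa [mem_cyl_iff_restr_eq.1 hx]
  · rintro ⟨hr, h⟩
    refine ⟨hr.1.union ?_, ?_, ?_, ?_⟩
    · refine (finite_range fun i => PSentence.notMem (x i) (nn i) (mm i)).subset ?_
      rintro _ ⟨i, rfl⟩
      exact ⟨i, rfl⟩
    · rintro y n (hy | ⟨i, hi⟩)
      · exact hr.2.1 y n hy
      · cases hi
    · rintro y n k ⟨hy | ⟨i, hi⟩, hy' | ⟨j, hj⟩⟩
      · exact hr.2.2.1 y n k ⟨hy, hy'⟩
      · cases hj
        exact (h j).1 _ hy rfl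
      all_goals cases hi
    · rintro y n m k ⟨hy | ⟨i, hi⟩, hy' | ⟨j, hj⟩⟩
      · exact hr.2.2.2 y n m k ⟨hy, hy'⟩
      · cases hj
      · cases hi
        exact (h i).2 _ hy' (mem_cyl_iff_restr_eq.2 (by simp [restr]))
      · cases hj

theorem isOpen_setOf_pvec_mem_PP (A : Set (ℕ → Bool)) (r : Set PSentence) {N : ℕ}
    (nn mm : Fin N → ℕ) : IsOpen {x | pvec r nn mm x ∈ PP A} := by
  by_cases hr : r ∈ PP A
  · simp only [pvec_mem_PP_iff, hr, true_and, ofPred_forall, ofPred_and]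
    refine isOpen_iInter_of_finite fun i => IsOpen.inter ?_ ?_
    · have hfin : {y | PSentence.mem y (nn i) ∈ r}.Finite :=
        hr.1.preimage fun a _ b _ hab => by injection hab
      exact hfin.isOpen_biInter fun y _ =>
        isClosed_singleton.isOpen_compl.preimage (continuous_apply i)
    · have hfin : {s | PSentence.cylSub s (nn i) (mm i) ∈ r}.Finite :=
        hr.1.preimage fun a _ b _ hab => by injection hab
      exact hfin.isOpen_biInter fun s _ =>
        (isClosed_cyl s).isOpen_compl.preimage (f := fun x : Fin N → (ℕ → Bool) => x i) (continuous_apply i)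
  · simp [pvec_mem_PP_iff, hr]

theorem pvec_union (p q : Set PSentence) {N : ℕ} (nn mm : Fin N → ℕ)
    (x : Fin N → (ℕ → Bool)) : pvec p nn mm x ∪ q = pvec (p ∪ q) nn mm x :=
  union_right_comm _ _ _

theorem IsTemplate.pvec_mem_PP {A Y : Set (ℕ → Bool)} {N : ℕ} {p : Set PSentence}
    {t : Fin N → List Bool} {nn mm : Fin N → ℕ} (hT : IsTemplate A Y N p t nn mm)
    {x : Fin N → (ℕ → Bool)} (hx : ∀ i, x i ∈ cyl (t i)) : pvec p nn mm x ∈ PP A := by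
  refine pvec_mem_PP_iff.2 ⟨hT.1.1, fun i => ⟨?_, fun s hs hxs => ?_⟩⟩
  · rintro y hy rfl
    exact hT.2.1 i _ hy (hx i)
  · exact (hT.2.2 i s hs).subset ⟨hxs, hx i⟩

/-- for a countable Y, a maximal antichain Σ ⊆ ℙ(A)_Y of ℙ(A),
any F : Σ → ω, and any Y-template, there is k < ω so that every
x⃗ ∈ ∏_{i<N}[t_i] admits q ∈ Σ with p(x⃗) ∪ q ∈ ℙ(A) and F(q) < k. -/
theorem template_bound (A Y : Set (ℕ → Bool)) (hY : Y.Countable)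
    (S : Set (Set PSentence)) (hSY : S ⊆ PPY A Y) (hS : PMaxAntichain A S)
    (F : S → ℕ)
    (N : ℕ) (p : Set PSentence) (t : Fin N → List Bool) (nn mm : Fin N → ℕ)
    (hT : IsTemplate A Y N p t nn mm) :
    ∃ k : ℕ, ∀ x : Fin N → (ℕ → Bool), (∀ i, x i ∈ cyl (t i)) →
      ∃ q, ∃ hq : q ∈ S, pvec p nn mm x ∪ q ∈ PP A ∧ F ⟨q, hq⟩ < k := by
  have hK : IsCompact {x : Fin N → (ℕ → Bool) | ∀ i, x i ∈ cyl (t i)} := by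
    rw [ofPred_forall]
    exact (isClosed_iInter fun i => (isClosed_cyl (t i)).preimage (continuous_apply i)).isCompact
  refine (hK.elim_directed_cover
    (fun k : ℕ => {x | ∃ q, ∃ hq : q ∈ S, pvec p nn mm x ∪ q ∈ PP A ∧ F ⟨q, hq⟩ < k}) ?_ ?_ ?_).imp
    fun k hk x hx => hk hx
  · intro k
    have hU : {x | ∃ q, ∃ hq : q ∈ S, pvec p nn mm x ∪ q ∈ PP A ∧ F ⟨q, hq⟩ < k} =
        ⋃ (q : S) (_ : F q < k), {x | pvec (p ∪ q) nn mm x ∈ PP A} := by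
      ext x
      simp only [pvec_union, mem_ofPred_eq, mem_iUnion, Subtype.exists, exists_prop, and_comm]
    rw [hU]
    exact isOpen_iUnion fun q => isOpen_iUnion fun _ => isOpen_setOf_pvec_mem_PP A _ nn mm
  · intro x hx
    obtain ⟨q, hq, hpq⟩ := hS.2 _ (hT.pvec_mem_PP hx)
    exact mem_iUnion.2 ⟨F ⟨q, hq⟩ + 1, q, hq, hpq, Nat.lt_succ_self _⟩
  · refine Monotone.directed_le ?_
    rintro k l hkl x ⟨q, hq, hpq, hlt⟩
    exact ⟨q, hq, hpq, hlt.trans_le hkl⟩
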